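/- arXiv:2310.18209 — 4 statements merged into one kernel-verified Lean document; each statement's English description precedes it below -/
import Mathlib

section
/- Let d ≥ 1, let Σ be a real symmetric positive definite d×d matrix, and let μ ∈ ℝ^d. Then −D(Σ, μ) ≤ log Erank(Σ) + log 4, where D(Σ, μ) = tr(Σ) − log det(Σ) − d + ‖μ‖₂² and Erank(Σ) is the effective rank of Σ. -/
open Real Matrix Finset

/-- For `d ≥ 1`, a real symmetric positive definite `d×d` matrix `S`, and
`μ ∈ ℝ^d`, we have `-D(S, μ) ≤ log (Erank S) + log 4`, where
`D(S, μ) = tr S - log det S - d + ‖μ‖₂²` and, with eigenvalues `λ i` of `S` and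
`q i = λ i / ∑ j, λ j`, `Erank S = exp (-∑ i, q i * log (q i))`. -/
theorem stmt0 {d : ℕ} (hd : 1 ≤ d) (S : Matrix (Fin d) (Fin d) ℝ) (hS : S.PosDef)
    (μ : EuclideanSpace ℝ (Fin d)) :
    -(S.trace - Real.log S.det - d + ‖μ‖ ^ 2) ≤
      Real.log (Real.exp (-(∑ i, (hS.isHermitian.eigenvalues i / ∑ j, hS.isHermitian.eigenvalues j) *
        Real.log (hS.isHermitian.eigenvalues i / ∑ j, hS.isHermitian.eigenvalues j)))) +
      Real.log 4 := by
  have hpos := hS.eigenvalues_pos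
  have hdet : Real.log S.det ≤ S.trace - d := by
    rw [hS.isHermitian.det_eq_prod_eigenvalues, hS.isHermitian.trace_eq_sum_eigenvalues]
    simp only [RCLike.ofReal_real_eq_id, id_eq]
    rw [Real.log_prod fun i _ => (hpos i).ne']
    calc ∑ i, Real.log (hS.isHermitian.eigenvalues i)
        ≤ ∑ i, (hS.isHermitian.eigenvalues i - 1) :=
          Finset.sum_le_sum fun i _ => Real.log_le_sub_one_of_pos (hpos i)
      _ = ∑ i, hS.isHermitian.eigenvalues i - d := by simp
  have hentropy : ∑ i, (hS.isHermitian.eigenvalues i / ∑ j, hS.isHermitian.eigenvalues j) *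
      Real.log (hS.isHermitian.eigenvalues i / ∑ j, hS.isHermitian.eigenvalues j) ≤ 0 := by
    have hsum : 0 ≤ ∑ j, hS.isHermitian.eigenvalues j :=
      Finset.sum_nonneg fun j _ => (hpos j).le
    refine Finset.sum_nonpos fun i _ => ?_
    have hq : 0 ≤ hS.isHermitian.eigenvalues i / ∑ j, hS.isHermitian.eigenvalues j :=
      div_nonneg (hpos i).le hsum
    refine mul_nonpos_of_nonneg_of_nonpos hq (Real.log_nonpos hq ?_)
    exact div_le_one_of_le₀
      (Finset.single_le_sum (fun j _ => (hpos j).le) (Finset.mem_univ i)) hsum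
  have hlog : 0 ≤ Real.log 4 := Real.log_nonneg (by norm_num)
  rw [Real.log_exp]
  linarith [sq_nonneg ‖μ‖]
end

section
/- Let d ≥ 1, let Σ and Σ′ be real symmetric positive definite d×d matrices, and let μ, μ′ ∈ ℝ^d. Then log Erank(Σ) + log Erank(Σ′) ≥ −(D(Σ, μ) + D(Σ′, μ′)) − 2 log 4. -/
open Real Matrix Finset

/-- The Shannon entropy of a normalized nonnegative vector is nonnegative. -/
lemma entropy_normalized_nonneg {ι : Type*} [Fintype ι] {v : ι → ℝ} (hv : ∀ i, 0 ≤ v i) :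
    0 ≤ -(∑ i, (v i / ∑ j, v j) * Real.log (v i / ∑ j, v j)) := by
  rw [← Finset.sum_neg_distrib]
  refine Finset.sum_nonneg fun i _ => ?_
  have hsum : 0 ≤ ∑ j, v j := Finset.sum_nonneg fun j _ => hv j
  have hle : v i ≤ ∑ j, v j := Finset.single_le_sum (fun j _ => hv j) (Finset.mem_univ i)
  have h := Real.negMulLog_nonneg (div_nonneg (hv i) hsum) (div_le_one_of_le₀ hle hsum)
  rwa [Real.negMulLog, neg_mul] at h

/-- The log-determinant divergence of a positive definite matrix from the identity
is nonnegative. -/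
lemma Matrix.PosDef.trace_sub_log_det_sub_card_nonneg {ι : Type*} [Fintype ι] [DecidableEq ι]
    {S : Matrix ι ι ℝ} (hS : S.PosDef) :
    0 ≤ S.trace - Real.log S.det - Fintype.card ι := by
  have htr : S.trace = ∑ i, hS.isHermitian.eigenvalues i := by
    simpa using hS.isHermitian.trace_eq_sum_eigenvalues
  have hdet : S.det = ∏ i, hS.isHermitian.eigenvalues i := by
    simpa using hS.isHermitian.det_eq_prod_eigenvalues
  have hlog : ∑ i, Real.log (hS.isHermitian.eigenvalues i) ≤
      ∑ i, (hS.isHermitian.eigenvalues i - 1) :=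
    Finset.sum_le_sum fun i _ => Real.log_le_sub_one_of_pos (hS.eigenvalues_pos i)
  rw [htr, hdet, Real.log_prod fun i _ => (hS.eigenvalues_pos i).ne']
  simp only [Finset.sum_sub_distrib, Finset.sum_const, Finset.card_univ, nsmul_eq_mul,
    mul_one] at hlog
  linarith

/-- For `d ≥ 1`, real symmetric positive definite `d×d` matrices `S`, `S'`, and
`μ, μ' ∈ ℝ^d`, we have `log (Erank S) + log (Erank S') ≥ -(D(S,μ) + D(S',μ')) - 2 log 4`,
where `D(S, μ) = tr S - log det S - d + ‖μ‖₂²` and, with eigenvalues `λ i` of `S` and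
`q i = λ i / ∑ j, λ j`, `Erank S = exp (-∑ i, q i * log (q i))`. -/
theorem stmt1 {d : ℕ} (hd : 1 ≤ d) (S S' : Matrix (Fin d) (Fin d) ℝ)
    (hS : S.PosDef) (hS' : S'.PosDef) (μ μ' : EuclideanSpace ℝ (Fin d)) :
    Real.log (Real.exp (-(∑ i, (hS.isHermitian.eigenvalues i / ∑ j, hS.isHermitian.eigenvalues j) *
        Real.log (hS.isHermitian.eigenvalues i / ∑ j, hS.isHermitian.eigenvalues j)))) +
    Real.log (Real.exp (-(∑ i, (hS'.isHermitian.eigenvalues i / ∑ j, hS'.isHermitian.eigenvalues j) *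
        Real.log (hS'.isHermitian.eigenvalues i / ∑ j, hS'.isHermitian.eigenvalues j)))) ≥
      -((S.trace - Real.log S.det - d + ‖μ‖ ^ 2) +
        (S'.trace - Real.log S'.det - d + ‖μ'‖ ^ 2)) - 2 * Real.log 4 := by
  simp only [Real.log_exp]
  have hE := entropy_normalized_nonneg fun i => (hS.eigenvalues_pos i).le
  have hE' := entropy_normalized_nonneg fun i => (hS'.eigenvalues_pos i).le
  have hD := hS.trace_sub_log_det_sub_card_nonneg
  have hD' := hS'.trace_sub_log_det_sub_card_nonneg
  rw [Fintype.card_fin] at hD hD'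
  have hlog : 0 ≤ Real.log 4 := Real.log_nonneg (by norm_num)
  linarith [sq_nonneg ‖μ‖, sq_nonneg ‖μ'‖]
end

section
/- Let d ≥ 1 and let Σ be a real symmetric positive definite d×d matrix with largest eigenvalue λ_max and smallest eigenvalue λ_min. Then tr(Σ) − log det(Σ) − d ≥ log(λ_max / λ_min) − log 4. -/
open Real Matrix Finset

/-- For positive reals `f i`, the sum of the nonnegative terms `f i - log (f i) - 1` dominates the
logarithm of any ratio `f i / f j`, up to the constant `log 4`. -/
theorem log_div_sub_log_four_le_sum {ι : Type*} [Fintype ι] {f : ι → ℝ} (hf : ∀ i, 0 < f i)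
    (i j : ι) :
    Real.log (f i / f j) - Real.log 4 ≤ ∑ k, (f k - Real.log (f k) - 1) := by
  classical
  have hnonneg : ∀ k ∈ univ, 0 ≤ f k - Real.log (f k) - 1 := fun k _ ↦ by
    linarith [Real.log_le_sub_one_of_pos (hf k)]
  by_cases hij : i = j
  · subst hij
    rw [div_self (hf i).ne', Real.log_one]
    linarith [Finset.sum_nonneg hnonneg, Real.log_nonneg (by norm_num : (1 : ℝ) ≤ 4)]
  · have hpair := Finset.sum_le_sum_of_subset_of_nonneg (subset_univ {i, j})
      fun k hk _ ↦ hnonneg k hk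
    rw [Finset.sum_pair hij] at hpair
    have hhalf := Real.log_le_sub_one_of_pos (half_pos (hf i))
    rw [Real.log_div (hf i).ne' two_ne_zero] at hhalf
    have hfour : Real.log 4 = 2 * Real.log 2 := by
      rw [show (4 : ℝ) = 2 ^ 2 by norm_num, Real.log_pow, Nat.cast_ofNat]
    rw [Real.log_div (hf i).ne' (hf j).ne']
    linarith [hf j]

/-- For `d ≥ 1` and a real symmetric positive definite `d×d` matrix `S` with
largest eigenvalue `λ_max` and smallest eigenvalue `λ_min`, we have
`tr S - log det S - d ≥ log (λ_max / λ_min) - log 4`. -/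
theorem stmt5 {d : ℕ} (hd : 1 ≤ d) (S : Matrix (Fin d) (Fin d) ℝ) (hS : S.PosDef) :
    Real.log ((Finset.univ.sup' (Finset.univ_nonempty_iff.mpr ⟨⟨0, hd⟩⟩) hS.isHermitian.eigenvalues) /
        (Finset.univ.inf' (Finset.univ_nonempty_iff.mpr ⟨⟨0, hd⟩⟩) hS.isHermitian.eigenvalues)) -
      Real.log 4 ≤ S.trace - Real.log S.det - d := by
  have hne : (univ : Finset (Fin d)).Nonempty := Finset.univ_nonempty_iff.mpr ⟨⟨0, hd⟩⟩
  obtain ⟨i, -, hi⟩ := Finset.exists_mem_eq_sup' hne hS.isHermitian.eigenvalues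
  obtain ⟨j, -, hj⟩ := Finset.exists_mem_eq_inf' hne hS.isHermitian.eigenvalues
  rw [hi, hj]
  refine (log_div_sub_log_four_le_sum hS.eigenvalues_pos i j).trans_eq ?_
  have htrace : S.trace = ∑ k, hS.isHermitian.eigenvalues k := by
    simpa using hS.isHermitian.trace_eq_sum_eigenvalues
  have hdet : S.det = ∏ k, hS.isHermitian.eigenvalues k := by
    simpa using hS.isHermitian.det_eq_prod_eigenvalues
  rw [hdet, Real.log_prod fun k _ ↦ (hS.eigenvalues_pos k).ne', htrace]
  simp [Finset.sum_sub_distrib]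
end

section
/- Let d ≥ 1, let h : ℝ → ℝ, let x ∈ ℝ^d with x ≠ 0, set r = ‖x‖, and suppose h is differentiable at r. Then the map f : ℝ^d → ℝ^d given by f(y) = h(‖y‖) · y is differentiable at x, and the determinant of its derivative at x (as a linear map ℝ^d → ℝ^d) equals h(r)^{d−1} · (h(r) + r · h′(r)). -/
open Real

theorem ContinuousLinearMap.det_smul_id_add_smulRight {E : Type*} [NormedAddCommGroup E]
    [NormedSpace ℝ E] [FiniteDimensional ℝ E] (hE : 1 ≤ Module.finrank ℝ E)
    (a : ℝ) (f : E →L[ℝ] ℝ) (v : E) :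
    (a • ContinuousLinearMap.id ℝ E + f.smulRight v).det =
      a ^ (Module.finrank ℝ E - 1) * (a + f v) := by
  have hcont : Continuous fun t : ℝ => (t • ContinuousLinearMap.id ℝ E + f.smulRight v).det :=
    ContinuousLinearMap.continuous_det.comp (by fun_prop)
  refine congrFun (Continuous.ext_on (dense_compl_singleton (0 : ℝ)) hcont
    (g := fun t => t ^ (Module.finrank ℝ E - 1) * (t + f v)) (by fun_prop) ?_) a
  intro t ht
  have ht : t ≠ 0 := ht
  have key : (t • ContinuousLinearMap.id ℝ E + f.smulRight v).toLinearMap =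
      t • LinearMap.transvection (t⁻¹ • f.toLinearMap) v := by
    ext w
    simp [LinearMap.transvection.apply, smul_smul, ht]
  obtain ⟨n, hn⟩ := Nat.exists_eq_add_of_le' hE
  simp only [ContinuousLinearMap.det, key, LinearMap.det_smul, LinearMap.transvection.det, hn,
    LinearMap.smul_apply, ContinuousLinearMap.coe_coe, smul_eq_mul, Nat.add_sub_cancel]
  field_simp
  ring

theorem hasFDerivAt_norm_of_ne_zero {E : Type*} [NormedAddCommGroup E] [InnerProductSpace ℝ E]
    {x : E} (hx : x ≠ 0) : HasFDerivAt (fun y : E => ‖y‖) (‖x‖⁻¹ • innerSL ℝ x) x := by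
  have hx' : ‖x‖ ≠ 0 := norm_ne_zero_iff.mpr hx
  have h := (hasStrictFDerivAt_norm_sq x).hasFDerivAt.sqrt (pow_ne_zero 2 hx')
  simp only [Real.sqrt_sq (norm_nonneg _)] at h
  convert! h using 1
  ext w
  simp
  field_simp

/-- For `d ≥ 1`, `h : ℝ → ℝ`, `x ∈ ℝ^d` with `x ≠ 0` and `r = ‖x‖`, if `h` is
differentiable at `r`, then `f : y ↦ h ‖y‖ • y` is differentiable at `x`, and the
determinant of its (Fréchet) derivative at `x` equals `h(r)^(d-1) * (h(r) + r * h'(r))`. -/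
theorem stmt11 {d : ℕ} (hd : 1 ≤ d) (h : ℝ → ℝ) (x : EuclideanSpace ℝ (Fin d))
    (hx : x ≠ 0) (hdiff : DifferentiableAt ℝ h ‖x‖) :
    DifferentiableAt ℝ (fun y : EuclideanSpace ℝ (Fin d) => h ‖y‖ • y) x ∧
    LinearMap.det (fderiv ℝ (fun y : EuclideanSpace ℝ (Fin d) => h ‖y‖ • y) x).toLinearMap =
      h ‖x‖ ^ (d - 1) * (h ‖x‖ + ‖x‖ * deriv h ‖x‖) := by
  have hx' : ‖x‖ ≠ 0 := norm_ne_zero_iff.mpr hx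
  have hf : HasFDerivAt (fun y : EuclideanSpace ℝ (Fin d) => h ‖y‖ • y)
      (h ‖x‖ • ContinuousLinearMap.id ℝ _ +
        (deriv h ‖x‖ • ‖x‖⁻¹ • innerSL ℝ x : EuclideanSpace ℝ (Fin d) →L[ℝ] ℝ).smulRight x) x :=
    (hdiff.hasDerivAt.comp_hasFDerivAt x (hasFDerivAt_norm_of_ne_zero hx)).smul (hasFDerivAt_id x)
  refine ⟨hf.differentiableAt, ?_⟩
  rw [hf.fderiv]
  refine (ContinuousLinearMap.det_smul_id_add_smulRight (by simpa using hd) _ _ _).trans ?_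
  simp only [finrank_euclideanSpace_fin, smul_apply, innerSL_apply_apply,
    real_inner_self_eq_norm_sq, smul_eq_mul]
  field_simp
end
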